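/- arXiv:1005.1849 — 4 statements merged into one kernel-verified Lean document; each statement's English description precedes it below -/
import Mathlib

section
/- Let ε > 0, let V : ℝ² → ℝ be smooth, let E : ℝ → ℝ, and let φ : ℝ² → ℂ be smooth such that for every x ∈ ℝ the functions y ↦ φ(x,y), y ↦ ∂_x φ(x,y) and y ↦ ∂_y φ(x,y) are Schwartz, ∫_ℝ |φ(x,y)|² dy = 1, the eigenvalue equation −∂²_y φ(x,y) + V(x,y) φ(x,y) = E(x) φ(x,y) holds for all y, and the number A(x) := −i ∫_ℝ conj(φ(x,y)) ∂_x φ(x,y) dy is real. Then for every smooth ψ : ℝ → ℂ and every x ∈ ℝ, ∫_ℝ ( ε² |ψ(x) ∂_xφ(x,y) + φ(x,y) ψ'(x)|² + |∂_yφ(x,y)|² |ψ(x)|² + V(x,y) |φ(x,y)|² |ψ(x)|² ) dy = | −iε ψ'(x) + ε A(x) ψ(x) |² + E(x) |ψ(x)|² + ε² ( ∫_ℝ |∂_xφ(x,y)|² dy − A(x)² ) |ψ(x)|². -/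
open MeasureTheory
open scoped ComplexConjugate

/-- Partial derivative in the first (tangential) variable. -/
noncomputable def pdx (φ : ℝ × ℝ → ℂ) (x y : ℝ) : ℂ := deriv (fun s => φ (s, y)) x

/-- Partial derivative in the second (transverse) variable. -/
noncomputable def pdy (φ : ℝ × ℝ → ℂ) (x y : ℝ) : ℂ := deriv (fun t => φ (x, t)) y

/-- Second partial derivative in the second (transverse) variable. -/
noncomputable def pdyy (φ : ℝ × ℝ → ℂ) (x y : ℝ) : ℂ := deriv (fun t => pdy φ x t) y

namespace SchwartzMap

lemma integrable_conj_mul (f g : SchwartzMap ℝ ℂ) :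
    Integrable (fun y => conj (f y) * g y) := by
  have h := MemLp.integrable_mul (f.memLp 2 volume).star (g.memLp 2 volume)
  exact h

lemma integrable_norm_sq (f : SchwartzMap ℝ ℂ) : Integrable (fun y => ‖f y‖ ^ 2) :=
  (memLp_two_iff_integrable_sq_norm f.continuous.aestronglyMeasurable).1 (f.memLp 2 volume)

/-- Expansion of the squared `L²` norm of a linear combination of two Schwartz functions. -/
lemma integral_norm_sq_linear_combination (f g : SchwartzMap ℝ ℂ) (a b : ℂ) :
    ∫ y, ‖a * g y + f y * b‖ ^ 2
      = ‖a‖ ^ 2 * (∫ y, ‖g y‖ ^ 2) + ‖b‖ ^ 2 * (∫ y, ‖f y‖ ^ 2)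
        + 2 * (conj b * a * ∫ y, conj (f y) * g y).re := by
  have hint : Integrable (fun y => conj b * a * (conj (f y) * g y)) :=
    (integrable_conj_mul f g).const_mul _
  have hpt : ∀ y, ‖a * g y + f y * b‖ ^ 2
      = ‖a‖ ^ 2 * ‖g y‖ ^ 2 + ‖b‖ ^ 2 * ‖f y‖ ^ 2
        + 2 * RCLike.re (conj b * a * (conj (f y) * g y)) := by
    intro y
    simp only [Complex.sq_norm, Complex.normSq_apply, RCLike.re_to_complex, Complex.add_re,
      Complex.add_im, Complex.mul_re, Complex.mul_im, Complex.conj_re, Complex.conj_im]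
    ring
  have hg := (integrable_norm_sq g).const_mul (‖a‖ ^ 2)
  have hf := (integrable_norm_sq f).const_mul (‖b‖ ^ 2)
  simp_rw [hpt]
  rw [integral_add (by exact hg.add hf) (hint.re.const_mul _), integral_add hg hf,
    integral_const_mul, integral_const_mul, integral_const_mul, integral_re hint,
    integral_const_mul, RCLike.re_to_complex]

/-- The derivative of `conj f * f'` is `|f'|² + conj f * f''`. -/
lemma hasDerivAt_conj_mul_deriv (f : SchwartzMap ℝ ℂ) (y : ℝ) :
    HasDerivAt (fun t => conj (f t) * deriv f t)
      (conj (deriv f y) * deriv f y + conj (f y) * deriv (deriv f) y) y := by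
  have h1 : HasDerivAt f (deriv f y) y := f.differentiableAt.hasDerivAt
  have h2 : HasDerivAt (deriv f) (deriv (deriv f) y) y :=
    (derivCLM ℂ ℂ f).differentiableAt.hasDerivAt
  exact h1.star.mul h2

lemma integrable_deriv_conj_mul_deriv (f : SchwartzMap ℝ ℂ) :
    Integrable
      (fun y => conj (deriv f y) * deriv f y + conj (f y) * deriv (deriv f) y) :=
  (integrable_conj_mul (derivCLM ℂ ℂ f) (derivCLM ℂ ℂ f)).add
    (integrable_conj_mul f (derivCLM ℂ ℂ (derivCLM ℂ ℂ f)))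

lemma integral_deriv_conj_mul_deriv (f : SchwartzMap ℝ ℂ) :
    ∫ y, (conj (deriv f y) * deriv f y + conj (f y) * deriv (deriv f) y) = 0 :=
  integral_eq_zero_of_hasDerivAt_of_integrable f.hasDerivAt_conj_mul_deriv
    f.integrable_deriv_conj_mul_deriv (integrable_conj_mul f (derivCLM ℂ ℂ f))

/-- If `f'' = (v - e) f`, then the energy density `|f'|² + v |f|²` differs from `e |f|²` by a
total derivative. -/
lemma energy_density_eq (f : SchwartzMap ℝ ℂ) {v e y : ℝ}
    (h : -deriv (deriv f) y + (v : ℂ) * f y = (e : ℂ) * f y) :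
    ‖deriv f y‖ ^ 2 + v * ‖f y‖ ^ 2 = e * ‖f y‖ ^ 2
      + RCLike.re (conj (deriv f y) * deriv f y + conj (f y) * deriv (deriv f) y) := by
  have h' : deriv (deriv f) y = (v : ℂ) * f y - (e : ℂ) * f y := by linear_combination -h
  rw [h']
  simp only [Complex.sq_norm, Complex.normSq_apply, RCLike.re_to_complex, Complex.add_re,
    Complex.sub_re, Complex.sub_im, Complex.mul_re, Complex.mul_im, Complex.conj_re,
    Complex.conj_im, Complex.ofReal_re, Complex.ofReal_im]
  ring

end SchwartzMap

/-- Quadratic-form identity underlying the effective Hamiltonian for a quantum wave guide: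
for the product wave function `Ψ(x,y) = φ(x,y)ψ(x)`, the energy density of
`−ε²∂²_x − ∂²_y + V`, integrated in the transverse variable `y`, equals the energy density of
the effective operator `(−iε∂_x + εA(x))² + E(x) + ε²(‖∂_xφ(x,·)‖² − A(x)²)`. -/
theorem stmt_6 (ε : ℝ) (hε : 0 < ε) (V : ℝ × ℝ → ℝ) (hV : ContDiff ℝ (⊤ : ℕ∞) V)
    (E : ℝ → ℝ) (φ : ℝ × ℝ → ℂ) (hφ : ContDiff ℝ (⊤ : ℕ∞) φ)
    (hS : ∀ x : ℝ, ∃ S : SchwartzMap ℝ ℂ, ∀ y : ℝ, S y = φ (x, y))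
    (hSx : ∀ x : ℝ, ∃ S : SchwartzMap ℝ ℂ, ∀ y : ℝ, S y = pdx φ x y)
    (hSy : ∀ x : ℝ, ∃ S : SchwartzMap ℝ ℂ, ∀ y : ℝ, S y = pdy φ x y)
    (hnorm : ∀ x : ℝ, ∫ y : ℝ, ‖φ (x, y)‖ ^ 2 = 1)
    (heig : ∀ x y : ℝ, -pdyy φ x y + (V (x, y) : ℂ) * φ (x, y) = (E x : ℂ) * φ (x, y))
    (A : ℝ → ℝ)
    (hA : ∀ x : ℝ, (A x : ℂ) = -Complex.I * ∫ y : ℝ, conj (φ (x, y)) * pdx φ x y)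
    (ψ : ℝ → ℂ) (hψ : ContDiff ℝ (⊤ : ℕ∞) ψ) (x : ℝ) :
    ∫ y : ℝ,
        (ε ^ 2 * ‖ψ x * pdx φ x y + φ (x, y) * deriv ψ x‖ ^ 2
          + ‖pdy φ x y‖ ^ 2 * ‖ψ x‖ ^ 2
          + V (x, y) * ‖φ (x, y)‖ ^ 2 * ‖ψ x‖ ^ 2)
      = ‖-Complex.I * (ε : ℂ) * deriv ψ x + (ε : ℂ) * (A x : ℂ) * ψ x‖ ^ 2
        + E x * ‖ψ x‖ ^ 2
        + ε ^ 2 * ((∫ y : ℝ, ‖pdx φ x y‖ ^ 2) - (A x) ^ 2) * ‖ψ x‖ ^ 2 := by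
  obtain ⟨f, hf⟩ := hS x
  obtain ⟨g, hg⟩ := hSx x
  have hpdy : ∀ y, pdy φ x y = deriv f y := fun y => by
    rw [pdy, ← funext hf]
  have hpdyy : ∀ y, pdyy φ x y = deriv (deriv f) y := fun y => by
    rw [pdyy, funext hpdy]
  have hn := hnorm x
  have hAx := hA x
  have he := heig x
  simp only [← hf, ← hg, hpdy, hpdyy] at hn hAx he ⊢
  have hJ : ∫ y, conj (f y) * g y = Complex.I * A x := by
    rw [hAx, ← mul_assoc, mul_neg, Complex.I_mul_I, neg_neg, one_mul]
  have hpt : ∀ y, ε ^ 2 * ‖ψ x * g y + f y * deriv ψ x‖ ^ 2 + ‖deriv f y‖ ^ 2 * ‖ψ x‖ ^ 2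
      + V (x, y) * ‖f y‖ ^ 2 * ‖ψ x‖ ^ 2
      = ε ^ 2 * ‖ψ x * g y + f y * deriv ψ x‖ ^ 2 + ‖ψ x‖ ^ 2 * (E x * ‖f y‖ ^ 2
        + RCLike.re (conj (deriv f y) * deriv f y + conj (f y) * deriv (deriv f) y)) := by
    intro y
    rw [← f.energy_density_eq (he y)]
    ring
  have hi₁ : Integrable (fun y => ‖ψ x * g y + f y * deriv ψ x‖ ^ 2) := by
    have h := (ψ x • g + deriv ψ x • f).integrable_norm_sq
    simpa [mul_comm (deriv ψ x)] using h
  have hi₂ := f.integrable_norm_sq.const_mul (E x)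
  have hi₃ := f.integrable_deriv_conj_mul_deriv
  simp_rw [hpt]
  rw [integral_add (hi₁.const_mul _) (.const_mul (by exact hi₂.add hi₃.re) _), integral_const_mul,
    integral_const_mul, integral_add hi₂ hi₃.re, integral_const_mul, integral_re hi₃,
    f.integral_deriv_conj_mul_deriv, f.integral_norm_sq_linear_combination, hn, hJ]
  simp only [Complex.sq_norm, Complex.normSq_apply, RCLike.re_to_complex, Complex.add_re,
    Complex.add_im, Complex.mul_re, Complex.mul_im, Complex.conj_re, Complex.conj_im,
    Complex.neg_re, Complex.neg_im, Complex.I_re, Complex.I_im, Complex.ofReal_re,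
    Complex.ofReal_im, Complex.zero_re]
  ring
end

section
/- Let Φ : ℝ² → ℝ be a real-valued Schwartz function, let θ : ℝ → ℝ be smooth, and define φ(x, n) := Φ(R_{θ(x)} n), where R_θ denotes the rotation of ℝ² given by R_θ(n₁,n₂) = (n₁ cos θ − n₂ sin θ, n₁ sin θ + n₂ cos θ). Then for every x ∈ ℝ: (i) ∫_{ℝ²} (∂_x φ(x,n))² dn = θ'(x)² ∫_{ℝ²} ( n₁ ∂_{n₂}Φ(n) − n₂ ∂_{n₁}Φ(n) )² dn, and (ii) ∫_{ℝ²} φ(x,n) ∂_x φ(x,n) dn = 0. In particular, ∫_{ℝ²} (∂_xφ)² dn − ( ∫_{ℝ²} φ ∂_xφ dn )² = θ'(x)² L²(Φ), where L²(Φ) := ∫_{ℝ²} (n₁∂_{n₂}Φ − n₂∂_{n₁}Φ)² dn is the expectation value of the squared angular momentum of Φ. -/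
open MeasureTheory

/-- Rotation of ℝ² by angle θ. -/
noncomputable def rot (θ : ℝ) (n : ℝ × ℝ) : ℝ × ℝ :=
  (n.1 * Real.cos θ - n.2 * Real.sin θ, n.1 * Real.sin θ + n.2 * Real.cos θ)

lemma measurePreserving_rot (θ : ℝ) : MeasurePreserving (rot θ) := by
  set M : Matrix (Fin 2) (Fin 2) ℝ := !![Real.cos θ, -Real.sin θ; Real.sin θ, Real.cos θ] with hM
  have hdet : LinearMap.det
      (Matrix.toLin (Module.Basis.finTwoProd ℝ) (Module.Basis.finTwoProd ℝ) M) = 1 := by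
    rw [LinearMap.det_toLin, hM, Matrix.det_fin_two_of]
    nlinarith [Real.sin_sq_add_cos_sq θ]
  have hrot : rot θ = Matrix.toLin (Module.Basis.finTwoProd ℝ) (Module.Basis.finTwoProd ℝ) M := by
    ext n <;> simp [rot, hM, Matrix.toLin_finTwoProd_apply] <;> ring
  refine ⟨by unfold rot; fun_prop, ?_⟩
  rw [hrot, Measure.map_linearMap_addHaar_eq_smul_addHaar _ (by simp [hdet]), hdet]
  simp

lemma integral_comp_rot (θ : ℝ) {f : ℝ × ℝ → ℝ} (hf : Continuous f) :
    ∫ n, f (rot θ n) = ∫ n, f n := by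
  have h := measurePreserving_rot θ
  rw [← integral_map h.measurable.aemeasurable hf.aestronglyMeasurable, h.map_eq]

lemma hasDerivAt_rot {θ : ℝ → ℝ} {x : ℝ} (hθ : DifferentiableAt ℝ θ x) (n : ℝ × ℝ) :
    HasDerivAt (fun s => rot (θ s) n)
      (deriv θ x • (-(rot (θ x) n).2, (rot (θ x) n).1)) x := by
  have hc := hθ.hasDerivAt.cos
  have hs := hθ.hasDerivAt.sin
  refine (((hc.const_mul n.1).sub (hs.const_mul n.2)).prodMk
    ((hs.const_mul n.1).add (hc.const_mul n.2))).congr_deriv ?_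
  ext <;> simp [rot] <;> ring

/-- The angular derivative `n₁ ∂₂f − n₂ ∂₁f`. -/
noncomputable def angularDeriv (f : ℝ × ℝ → ℝ) (n : ℝ × ℝ) : ℝ :=
  n.1 * fderiv ℝ f n (0, 1) - n.2 * fderiv ℝ f n (1, 0)

lemma fderiv_apply_neg_snd_fst (f : ℝ × ℝ → ℝ) (n : ℝ × ℝ) :
    fderiv ℝ f n (-n.2, n.1) = angularDeriv f n := by
  have h : ((-n.2, n.1) : ℝ × ℝ) = n.1 • (0, 1) - n.2 • (1, 0) := by
    ext <;> simp
  rw [h, map_sub, map_smul, map_smul, smul_eq_mul, smul_eq_mul, angularDeriv]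

lemma deriv_comp_rot {f : ℝ × ℝ → ℝ} (hf : Differentiable ℝ f) {θ : ℝ → ℝ} {x : ℝ}
    (hθ : DifferentiableAt ℝ θ x) (n : ℝ × ℝ) :
    deriv (fun s => f (rot (θ s) n)) x = deriv θ x * angularDeriv f (rot (θ x) n) := by
  have h := (hf (rot (θ x) n)).hasFDerivAt.comp_hasDerivAt x (hasDerivAt_rot hθ n)
  rw [map_smul, fderiv_apply_neg_snd_fst, smul_eq_mul] at h
  exact h.deriv

lemma continuous_angularDeriv (Φ : SchwartzMap (ℝ × ℝ) ℝ) : Continuous (angularDeriv Φ) := by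
  have h : Continuous (fderiv ℝ (⇑Φ)) := (Φ.smooth 1).continuous_fderiv one_ne_zero
  unfold angularDeriv
  fun_prop

section

open scoped LineDeriv SchwartzMap

variable {E : Type*} [NormedAddCommGroup E] [NormedSpace ℝ E]

lemma SchwartzMap.clm_smulLeft_apply (L : E →L[ℝ] ℝ) (f : 𝓢(E, ℝ)) (n : E) :
    SchwartzMap.smulLeftCLM ℝ (⇑L) f n = L n * f n :=
  SchwartzMap.smulLeftCLM_apply_apply L.hasTemperateGrowth f n

variable [MeasurableSpace E] [BorelSpace E] [FiniteDimensional ℝ E] (μ : Measure E)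
  [μ.IsAddHaarMeasure]

lemma SchwartzMap.integrable_mul_clm_mul_fderiv (L : E →L[ℝ] ℝ) (v : E) (f : 𝓢(E, ℝ)) :
    Integrable (fun n => f n * (L n * fderiv ℝ f n v)) μ := by
  refine (SchwartzMap.pairing (ContinuousLinearMap.mul ℝ ℝ) f
    (SchwartzMap.smulLeftCLM ℝ (⇑L) (∂_{v} f))).integrable.congr (.of_forall fun n => ?_)
  simp [SchwartzMap.pairing_apply_apply, clm_smulLeft_apply, lineDerivOp_apply_eq_fderiv]

lemma SchwartzMap.integral_mul_clm_mul_fderiv_eq_zero {L : E →L[ℝ] ℝ} {v : E} (hL : L v = 0)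
    (f : 𝓢(E, ℝ)) : ∫ n, f n * (L n * fderiv ℝ f n v) ∂μ = 0 := by
  have h := SchwartzMap.integral_mul_lineDerivOp_right_eq_neg_left (μ := μ)
    (SchwartzMap.smulLeftCLM ℝ (⇑L) f) f v
  have hd (n : E) : (∂_{v} (SchwartzMap.smulLeftCLM ℝ (⇑L) f)) n = L n * fderiv ℝ f n v := by
    have hfun : ⇑(SchwartzMap.smulLeftCLM ℝ (⇑L) f) = fun n => L n * f n :=
      funext (clm_smulLeft_apply L f)
    rw [lineDerivOp_apply_eq_fderiv, hfun, fderiv_fun_mul L.differentiableAt f.differentiableAt]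
    simp [hL]
  simp only [hd, clm_smulLeft_apply, lineDerivOp_apply_eq_fderiv] at h
  have e₁ : ∫ n, L n * f n * fderiv ℝ f n v ∂μ = ∫ n, f n * (L n * fderiv ℝ f n v) ∂μ :=
    integral_congr_ae (.of_forall fun n => by ring)
  have e₂ : ∫ n, L n * fderiv ℝ f n v * f n ∂μ = ∫ n, f n * (L n * fderiv ℝ f n v) ∂μ :=
    integral_congr_ae (.of_forall fun n => by ring)
  rw [e₁, e₂] at h
  linarith

end

lemma integral_mul_angularDeriv (Φ : SchwartzMap (ℝ × ℝ) ℝ) :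
    ∫ n, Φ n * angularDeriv Φ n = 0 := by
  have h₁ := Φ.integral_mul_clm_mul_fderiv_eq_zero volume
    (L := ContinuousLinearMap.fst ℝ ℝ ℝ) (v := (0, 1)) (by simp)
  have h₂ := Φ.integral_mul_clm_mul_fderiv_eq_zero volume
    (L := ContinuousLinearMap.snd ℝ ℝ ℝ) (v := (1, 0)) (by simp)
  have h := integral_sub
    (Φ.integrable_mul_clm_mul_fderiv volume (ContinuousLinearMap.fst ℝ ℝ ℝ) (0, 1))
    (Φ.integrable_mul_clm_mul_fderiv volume (ContinuousLinearMap.snd ℝ ℝ ℝ) (1, 0))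
  rw [h₁, h₂, sub_zero] at h
  simpa only [angularDeriv, mul_sub, ContinuousLinearMap.coe_fst',
    ContinuousLinearMap.coe_snd'] using h

/-- The Born–Huang term produced by twisting: for `φ(x,n) = Φ(R_{θ(x)} n)` with `Φ` Schwartz,
(i) `∫ (∂_xφ)² dn = θ'(x)² ∫ (n₁∂₂Φ − n₂∂₁Φ)² dn`, (ii) `∫ φ ∂_xφ dn = 0`, and hence
`∫ (∂_xφ)² dn − (∫ φ ∂_xφ dn)² = θ'(x)² L²(Φ)` with `L²(Φ)` the expectation value of the
squared angular momentum of `Φ`. -/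
theorem stmt_10 (Φ : SchwartzMap (ℝ × ℝ) ℝ) (θ : ℝ → ℝ) (hθ : ContDiff ℝ (⊤ : ℕ∞) θ)
    (φ : ℝ → ℝ × ℝ → ℝ) (hφ : ∀ x n, φ x n = Φ (rot (θ x) n)) (x : ℝ) :
    (∫ n : ℝ × ℝ, (deriv (fun s => φ s n) x) ^ 2
        = (deriv θ x) ^ 2 *
          ∫ n : ℝ × ℝ, (n.1 * fderiv ℝ (⇑Φ) n (0, 1) - n.2 * fderiv ℝ (⇑Φ) n (1, 0)) ^ 2) ∧
    (∫ n : ℝ × ℝ, φ x n * deriv (fun s => φ s n) x = 0) ∧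
    ((∫ n : ℝ × ℝ, (deriv (fun s => φ s n) x) ^ 2)
        - (∫ n : ℝ × ℝ, φ x n * deriv (fun s => φ s n) x) ^ 2
      = (deriv θ x) ^ 2 *
          ∫ n : ℝ × ℝ, (n.1 * fderiv ℝ (⇑Φ) n (0, 1) - n.2 * fderiv ℝ (⇑Φ) n (1, 0)) ^ 2) := by
  have hderiv (n : ℝ × ℝ) :
      deriv (fun s => φ s n) x = deriv θ x * angularDeriv Φ (rot (θ x) n) := by
    simp only [hφ]
    exact deriv_comp_rot Φ.differentiable (hθ.differentiable (by simp) x) n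
  have hA := continuous_angularDeriv Φ
  have h₁ : ∫ n : ℝ × ℝ, (deriv (fun s => φ s n) x) ^ 2
      = (deriv θ x) ^ 2 * ∫ n : ℝ × ℝ, angularDeriv Φ n ^ 2 := by
    simp only [hderiv, mul_pow]
    rw [integral_const_mul, integral_comp_rot (θ x) (f := fun n => angularDeriv Φ n ^ 2)
      (hA.pow 2)]
  have h₂ : ∫ n : ℝ × ℝ, φ x n * deriv (fun s => φ s n) x = 0 := by
    simp only [hderiv, mul_left_comm _ (deriv θ x)]
    simp only [hφ]
    rw [integral_const_mul, integral_comp_rot (θ x) (f := fun n => Φ n * angularDeriv Φ n)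
      (Φ.continuous.mul hA), integral_mul_angularDeriv, mul_zero]
  refine ⟨h₁, h₂, ?_⟩
  rw [h₂, zero_pow two_ne_zero, sub_zero]
  exact h₁
end

section
/- Let H be a complex Hilbert space and let P, Q be orthogonal projections on H (bounded operators with P = P* = P² and Q = Q* = Q²) such that ‖P − Q‖ < 1. Then S := 1 − (P − Q)² is a positive invertible bounded self-adjoint operator, and the Sz.-Nagy operator W := ( Q P + (1 − Q)(1 − P) ) S^{−1/2}, where S^{−1/2} denotes the (unique) positive square root of S^{−1}, is unitary (W*W = 1 = WW*) and intertwines the projections: W P = Q W. -/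
open ContinuousLinearMap

section Ring

variable {A : Type*} [Ring A] {p q : A}

lemma szNagy_mul_reverse (hp : p * p = p) (hq : q * q = q) :
    (q * p + (1 - q) * (1 - p)) * (p * q + (1 - p) * (1 - q)) = 1 - (p - q) * (p - q) := by
  have hp' (x : A) : p * (p * x) = p * x := by rw [← mul_assoc, hp]
  simp only [mul_add, add_mul, mul_sub, sub_mul, mul_one, one_mul, mul_assoc, hp, hq, hp']
  abel

lemma szNagy_reverse_mul (hp : p * p = p) (hq : q * q = q) :
    (p * q + (1 - p) * (1 - q)) * (q * p + (1 - q) * (1 - p)) = 1 - (p - q) * (p - q) := by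
  rw [szNagy_mul_reverse hq hp, ← neg_sub p q, neg_mul_neg]

lemma szNagy_intertwines (hp : p * p = p) (hq : q * q = q) :
    (q * p + (1 - q) * (1 - p)) * p = q * (q * p + (1 - q) * (1 - p)) := by
  have hq' (x : A) : q * (q * x) = q * x := by rw [← mul_assoc, hq]
  simp only [mul_add, add_mul, mul_sub, sub_mul, mul_one, one_mul, mul_assoc, hp, hq, hq']
  abel

lemma commute_left_one_sub_sq_sub (hp : p * p = p) (hq : q * q = q) :
    Commute p (1 - (p - q) * (p - q)) := by
  have hp' (x : A) : p * (p * x) = p * x := by rw [← mul_assoc, hp]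
  simp only [Commute, SemiconjBy, mul_sub, sub_mul, mul_one, one_mul, mul_assoc, hp, hq, hp']
  abel

lemma commute_right_one_sub_sq_sub (hp : p * p = p) (hq : q * q = q) :
    Commute q (1 - (p - q) * (p - q)) := by
  rw [← neg_sub q p, neg_mul_neg]
  exact commute_left_one_sub_sq_sub hq hp

lemma Commute.of_inverse {a s t : A} (h : Commute a s) (hts : t * s = 1) (hst : s * t = 1) :
    Commute a t :=
  Commute.units_inv_right (u := ⟨s, t, hst, hts⟩) h

end Ring

theorem stmt_11 {H : Type*} [NormedAddCommGroup H] [InnerProductSpace ℂ H] [CompleteSpace H]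
    (P Q : H →L[ℂ] H)
    (hP : IsSelfAdjoint P) (hP2 : P * P = P)
    (hQ : IsSelfAdjoint Q) (hQ2 : Q * Q = Q)
    (hPQ : ‖P - Q‖ < 1) :
    (1 - (P - Q) * (P - Q)).IsPositive ∧ IsUnit (1 - (P - Q) * (P - Q)) ∧
    ∀ R : H →L[ℂ] H, R.IsPositive →
      R * R * (1 - (P - Q) * (P - Q)) = 1 →
      (1 - (P - Q) * (P - Q)) * (R * R) = 1 →
      (adjoint ((Q * P + (1 - Q) * (1 - P)) * R)) * ((Q * P + (1 - Q) * (1 - P)) * R) = 1 ∧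
      ((Q * P + (1 - Q) * (1 - P)) * R) * (adjoint ((Q * P + (1 - Q) * (1 - P)) * R)) = 1 ∧
      ((Q * P + (1 - Q) * (1 - P)) * R) * P = Q * ((Q * P + (1 - Q) * (1 - P)) * R) := by
  have hV : adjoint (Q * P + (1 - Q) * (1 - P)) = P * Q + (1 - P) * (1 - Q) := by
    rw [← star_eq_adjoint]
    simp [hP.star_eq, hQ.star_eq]
  have hVV := szNagy_reverse_mul hP2 hQ2
  have hVV' := szNagy_mul_reverse hP2 hQ2
  have hVP := szNagy_intertwines hP2 hQ2
  have hcP := commute_left_one_sub_sq_sub hP2 hQ2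
  have hcQ := commute_right_one_sub_sq_sub hP2 hQ2
  refine ⟨?_, ?_, fun R hR hRS hSR ↦ ?_⟩
  · rw [← hVV, ← hV, ← star_eq_adjoint, ← nonneg_iff_isPositive]
    exact star_mul_self_nonneg _
  · refine isUnit_one_sub_of_norm_lt_one ((norm_mul_le _ _).trans_lt ?_)
    nlinarith [norm_nonneg (P - Q)]
  have hR0 : 0 ≤ R := (nonneg_iff_isPositive R).2 hR
  have hcR {X : H →L[ℂ] H} (h : Commute X (1 - (P - Q) * (P - Q))) : Commute X R := by
    rw [← CFC.sqrt_mul_self R, CFC.sqrt_eq_cfc]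
    exact ((h.of_inverse hRS hSR).symm.cfc_nnreal _).symm
  have hRP : Commute P R := hcR hcP
  have hRS' := hcR (Commute.refl _)
  have hRa : adjoint R = R := hR.isSelfAdjoint.adjoint_eq
  have hcV : Commute (Q * P + (1 - Q) * (1 - P)) R := hcR <|
    (hcQ.mul_left hcP).add_left
      (((Commute.one_left _).sub_left hcQ).mul_left ((Commute.one_left _).sub_left hcP))
  have hWa : adjoint ((Q * P + (1 - Q) * (1 - P)) * R) =
      R * (P * Q + (1 - P) * (1 - Q)) := by
    rw [← star_eq_adjoint, star_mul, star_eq_adjoint, star_eq_adjoint, hV, hRa]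
  rw [hWa]
  generalize Q * P + (1 - Q) * (1 - P) = V at *
  generalize P * Q + (1 - P) * (1 - Q) = V' at *
  refine ⟨?_, ?_, ?_⟩
  · rw [mul_assoc, ← mul_assoc V', hVV, hRS'.eq, ← mul_assoc, hRS]
  · rw [hcV.eq, mul_assoc, ← mul_assoc V, hcV.eq, mul_assoc R V, hVV', ← mul_assoc, hRS]
  · rw [mul_assoc, ← hRP.eq, ← mul_assoc, hVP, mul_assoc]
end

section
/- Let A be a complex C*-algebra. Let P ∈ A with P = P* = P², let T ∈ A with T* = −T, P T P = 0 and (1 − P) T (1 − P) = 0, and let T₂ ∈ A with T₂ + T₂* = −T T*. Set P₁ := T*P + P T and P₂ := T* P T + T₂* P + P T₂. Then P₁² + P P₂ + P₂ P = P₂, and consequently for every scalar ε, (P + ε P₁ + ε² P₂)² = (P + ε P₁ + ε² P₂) + ε³ (P₁ P₂ + P₂ P₁) + ε⁴ P₂². -/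
/-- If `P₁` and `P₂` solve the first and second order projection equations at an idempotent `P`,
then `P + εP₁ + ε²P₂` is idempotent up to explicit terms of order `ε³`. -/
theorem mul_self_add_smul_add_sq_smul {R A : Type*} [CommRing R] [Ring A] [Algebra R A]
    {P P₁ P₂ : A} (h0 : P * P = P) (h1 : P * P₁ + P₁ * P = P₁)
    (h2 : P₁ * P₁ + P * P₂ + P₂ * P = P₂) (ε : R) :
    (P + ε • P₁ + ε ^ 2 • P₂) * (P + ε • P₁ + ε ^ 2 • P₂)
      = (P + ε • P₁ + ε ^ 2 • P₂) + ε ^ 3 • (P₁ * P₂ + P₂ * P₁) + ε ^ 4 • (P₂ * P₂) := by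
  calc (P + ε • P₁ + ε ^ 2 • P₂) * (P + ε • P₁ + ε ^ 2 • P₂)
      = P * P + ε • (P * P₁ + P₁ * P) + ε ^ 2 • (P₁ * P₁ + P * P₂ + P₂ * P)
        + ε ^ 3 • (P₁ * P₂ + P₂ * P₁) + ε ^ 4 • (P₂ * P₂) := by
        simp only [mul_add, add_mul, smul_mul_assoc, mul_smul_comm, smul_smul, smul_add]
        module
    _ = _ := by rw [h0, h1, h2]

/-- Second-order super-adiabatic ansatz: in a C*-algebra, for a self-adjoint idempotent `P`,
an anti-symmetric off-diagonal `T` (`PTP = 0`, `(1−P)T(1−P) = 0`) and `T₂` with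
`T₂ + T₂* = −TT*`, the corrections `P₁ = T*P + PT` and `P₂ = T*PT + T₂*P + PT₂` satisfy
`P₁² + PP₂ + P₂P = P₂`, hence
`(P + εP₁ + ε²P₂)² = (P + εP₁ + ε²P₂) + ε³(P₁P₂ + P₂P₁) + ε⁴P₂²` for every scalar `ε`. -/
theorem stmt_13 {A : Type*} [NormedRing A] [StarRing A] [CStarRing A]
    [NormedAlgebra ℂ A] [StarModule ℂ A] [CompleteSpace A]
    (P : A) (hP : star P = P) (hP2 : P * P = P)
    (T : A) (hT : star T = -T)
    (hoff1 : P * T * P = 0) (hoff2 : (1 - P) * T * (1 - P) = 0)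
    (T₂ : A) (hT₂ : T₂ + star T₂ = -(T * star T))
    (P₁ P₂ : A)
    (hP₁ : P₁ = star T * P + P * T)
    (hP₂ : P₂ = star T * P * T + star T₂ * P + P * T₂) :
    (P₁ * P₁ + P * P₂ + P₂ * P = P₂) ∧
    ∀ ε : ℂ,
      (P + ε • P₁ + ε ^ 2 • P₂) * (P + ε • P₁ + ε ^ 2 • P₂)
        = (P + ε • P₁ + ε ^ 2 • P₂) + ε ^ 3 • (P₁ * P₂ + P₂ * P₁) + ε ^ 4 • (P₂ * P₂) := by
  have hPT : P * T = T - T * P := by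
    have h : (1 - P) * T * (1 - P) = T - T * P - P * T + P * T * P := by noncomm_ring
    rw [hoff2, hoff1, add_zero] at h
    exact (sub_eq_zero.mp h.symm).symm
  have hTPT : T * P * T = T * T - T * T * P := by
    rw [mul_assoc, hPT, mul_sub, mul_assoc]
  have hPTT : P * (T * T) = T * T * P := by
    rw [← mul_assoc, hPT, sub_mul, hTPT, sub_sub_cancel]
  have hTTPP : T * T * P * P = T * T * P := by rw [mul_assoc, hP2]
  have hS : star T₂ = T * T - T₂ := by
    rw [hT, mul_neg, neg_neg] at hT₂
    exact eq_sub_of_add_eq' hT₂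
  have hP₁' : P₁ = P * T - T * P := by
    rw [hP₁, hT]
    noncomm_ring
  have hP₂' : P₂ = 2 * (T * T * P) - T * T + (P * T₂ - T₂ * P) := by
    rw [hP₂, hT, hS, neg_mul, neg_mul, hTPT]
    noncomm_ring
  have h1 : P * P₁ + P₁ * P = P₁ := by
    calc P * P₁ + P₁ * P = P * P * T - T * (P * P) := by rw [hP₁']; noncomm_ring
      _ = P₁ := by rw [hP2, hP₁']
  have hsq : P₁ * P₁ = -(T * T) := by
    calc P₁ * P₁ = (P * T * P) * T - P * (T * T) * P - T * (P * P) * T + T * (P * T * P) := by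
          rw [hP₁']; noncomm_ring
      _ = -(T * T) := by
          rw [hoff1, hP2, hPTT, hTTPP, hTPT]; noncomm_ring
  have hcomm : P * P₂ + P₂ * P = 2 * (T * T * P) + (P * T₂ - T₂ * P) := by
    calc P * P₂ + P₂ * P
        = 2 * (P * (T * T) * P) - P * (T * T) + 2 * (T * T * P * P) - T * T * P
          + (P * P * T₂ - T₂ * (P * P)) := by rw [hP₂']; noncomm_ring
      _ = _ := by rw [hPTT, hTTPP, hP2]; noncomm_ring
  have h2 : P₁ * P₁ + P * P₂ + P₂ * P = P₂ := by
    rw [add_assoc, hsq, hcomm, hP₂']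
    abel
  exact ⟨h2, mul_self_add_smul_add_sq_smul hP2 h1 h2⟩
end
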